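/- arXiv:2408.04352 — 7 statements merged into one kernel-verified Lean document; each statement's English description precedes it below -/
import Mathlib

section
/- Let K be a nonempty subset of ℝⁿ and f : ℝⁿ → ℝˢ a mapping. If SOL^W(K, f) is nonempty, then there exist an index i₀ ∈ {1,…,s} and a point x₀ ∈ K such that f_{i₀}(x) = f_{i₀}(x₀) for every x ∈ K_{x₀}; moreover this x₀ satisfies x₀ ∈ SOL^W(K_{x₀}, f) and x₀ ∈ SOL^W(K, f). -/
/-- The weak Pareto efficient solution set of VOP(K, f). -/
def SOLW {n s : ℕ} (K : Set (Fin n → ℝ)) (f : (Fin n → ℝ) → Fin s → ℝ) :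
    Set (Fin n → ℝ) :=
  {y ∈ K | ¬ ∃ x ∈ K, ∀ i, f x i < f y i}

/-- The section K_{x'} = {x ∈ K : fᵢ(x) ≤ fᵢ(x') for all i}. -/
def subK {n s : ℕ} (K : Set (Fin n → ℝ)) (f : (Fin n → ℝ) → Fin s → ℝ)
    (x' : Fin n → ℝ) : Set (Fin n → ℝ) :=
  {x ∈ K | ∀ i, f x i ≤ f x' i}

theorem mem_SOLW_of_mem_subK {n s : ℕ} {K : Set (Fin n → ℝ)}
    {f : (Fin n → ℝ) → Fin s → ℝ} {x y : Fin n → ℝ} (hy : y ∈ SOLW K f)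
    (hx : x ∈ subK K f y) : x ∈ SOLW K f :=
  ⟨hx.1, fun ⟨z, hz, hlt⟩ => hy.2 ⟨z, hz, fun i => (hlt i).trans_le (hx.2 i)⟩⟩

/-- If every objective can be strictly decreased inside the section of any weak Pareto point,
then any finite set of objectives can be strictly decreased simultaneously. -/
theorem exists_mem_subK_forall_lt {n s : ℕ} {K : Set (Fin n → ℝ)}
    {f : (Fin n → ℝ) → Fin s → ℝ} {y : Fin n → ℝ} (hy : y ∈ SOLW K f)
    (hdec : ∀ i, ∀ x ∈ SOLW K f, ∃ z ∈ subK K f x, f z i < f x i) (T : Finset (Fin s)) :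
    ∃ x ∈ subK K f y, ∀ i ∈ T, f x i < f y i := by
  induction T using Finset.induction_on with
  | empty => exact ⟨y, ⟨hy.1, fun _ => le_rfl⟩, by simp⟩
  | insert j T _ ih =>
    obtain ⟨x, hx, hlt⟩ := ih
    obtain ⟨z, hz, hzj⟩ := hdec j x (mem_SOLW_of_mem_subK hy hx)
    refine ⟨z, ⟨hz.1, fun i => (hz.2 i).trans (hx.2 i)⟩, fun i hi => ?_⟩
    rcases Finset.mem_insert.mp hi with rfl | hi
    · exact hzj.trans_le (hx.2 i)
    · exact (hz.2 i).trans_lt (hlt i hi)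

theorem stmt_2 {n s : ℕ} (K : Set (Fin n → ℝ)) (hK : K.Nonempty)
    (f : (Fin n → ℝ) → Fin s → ℝ) (h : (SOLW K f).Nonempty) :
    ∃ (i₀ : Fin s) (x₀ : Fin n → ℝ), x₀ ∈ K ∧
      (∀ x ∈ subK K f x₀, f x i₀ = f x₀ i₀) ∧
      x₀ ∈ SOLW (subK K f x₀) f ∧ x₀ ∈ SOLW K f := by
  obtain ⟨y, hy⟩ := h
  obtain ⟨i₀, x₀, hx₀, hmin⟩ : ∃ i, ∃ x ∈ SOLW K f, ∀ z ∈ subK K f x, f x i ≤ f z i := by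
    by_contra! hdec
    obtain ⟨x, hx, hlt⟩ := exists_mem_subK_forall_lt hy hdec Finset.univ
    exact hy.2 ⟨x, hx.1, fun i => hlt i (Finset.mem_univ i)⟩
  exact ⟨i₀, x₀, hx₀.1, fun x hx => (hx.2 i₀).antisymm (hmin x hx),
    ⟨⟨hx₀.1, fun _ => le_rfl⟩, fun ⟨z, hz, hlt⟩ => hx₀.2 ⟨z, hz.1, hlt⟩⟩, hx₀⟩
end

section
/- Let K be a nonempty subset of ℝⁿ and f : ℝⁿ → ℝˢ a mapping. Then SOL^W(K, f) is nonempty if and only if there exist an index i₀ ∈ {1,…,s} and a point x₀ ∈ K such that f_{i₀}(x) = f_{i₀}(x₀) for every x ∈ K_{x₀}. -/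
theorem stmt_3 {n s : ℕ} (K : Set (Fin n → ℝ)) (hK : K.Nonempty)
    (f : (Fin n → ℝ) → Fin s → ℝ) :
    (SOLW K f).Nonempty ↔
      ∃ (i₀ : Fin s) (x₀ : Fin n → ℝ), x₀ ∈ K ∧
        ∀ x ∈ subK K f x₀, f x i₀ = f x₀ i₀ := by
  classical
  constructor
  · rintro ⟨y, hyK, hy⟩
    -- Choose a point of `subK K f y` whose set of strictly improved objectives is maximal.
    let J : (Fin n → ℝ) → Finset (Fin s) := fun x => {i | f x i < f y i}
    have hne : (Set.image J (subK K f y)).Nonempty := ⟨J y, y, ⟨hyK, fun _ => le_rfl⟩, rfl⟩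
    obtain ⟨_, ⟨x₀, ⟨hx₀K, hx₀⟩, rfl⟩, hmax⟩ :=
      (Set.toFinite (Set.image J (subK K f y))).exists_maximal hne
    obtain ⟨i₀, hi₀⟩ : ∃ i, f y i ≤ f x₀ i := by
      by_contra! h
      exact hy ⟨x₀, hx₀K, h⟩
    refine ⟨i₀, x₀, hx₀K, fun x ⟨hxK, hx⟩ => (hx i₀).antisymm ?_⟩
    by_contra! hlt
    have hsub : J x₀ ≤ J x := fun i hi => by
      simp only [J, Finset.mem_filter_univ] at hi ⊢
      exact (hx i).trans_lt hi
    have hmem : i₀ ∈ J x := by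
      simpa [J] using hlt.trans_le (hx₀ i₀)
    have hmem₀ := hmax ⟨x, ⟨hxK, fun i => (hx i).trans (hx₀ i)⟩, rfl⟩ hsub hmem
    simp only [J, Finset.mem_filter_univ] at hmem₀
    exact hmem₀.not_ge hi₀
  · rintro ⟨i₀, x₀, hx₀K, hconst⟩
    refine ⟨x₀, hx₀K, ?_⟩
    rintro ⟨x, hxK, hx⟩
    exact (hx i₀).ne (hconst x ⟨hxK, fun i => (hx i).le⟩)
end

section
/- Let K be a nonempty subset of ℝⁿ and f : ℝⁿ → ℝˢ a mapping. The following are equivalent: (i) SOL^W(K, f) is nonempty; (ii) there exists x₀ ∈ K such that the index set I := {i ∈ {1,…,s} : f_i(x) = f_i(x₀) for all x ∈ K_{x₀}} is nonempty and x₀ is a Pareto efficient solution of VOP(K_{x₀}, f_I), i.e., x₀ ∈ SOL^S(K_{x₀}, f_I). -/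
/-- The (strong) Pareto efficient solution set of VOP(K, f_I), where f_I keeps
only the components of f indexed by I. -/
def SOLSI {n s : ℕ} (K : Set (Fin n → ℝ)) (f : (Fin n → ℝ) → Fin s → ℝ)
    (I : Set (Fin s)) : Set (Fin n → ℝ) :=
  {y ∈ K | ¬ ∃ x ∈ K, (∀ i ∈ I, f x i ≤ f y i) ∧ ∃ j ∈ I, f x j < f y j}

theorem stmt_6 {n s : ℕ} (K : Set (Fin n → ℝ)) (hK : K.Nonempty)
    (f : (Fin n → ℝ) → Fin s → ℝ) :
    (SOLW K f).Nonempty ↔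
      ∃ x₀ ∈ K,
        {i : Fin s | ∀ x ∈ subK K f x₀, f x i = f x₀ i}.Nonempty ∧
        x₀ ∈ SOLSI (subK K f x₀) f
          {i : Fin s | ∀ x ∈ subK K f x₀, f x i = f x₀ i} := by
  constructor
  · rintro ⟨y, hyK, hy⟩
    -- maximize the set of coordinates strictly improved on `y`
    let J : (Fin n → ℝ) → Set (Fin s) := fun x => {i | f x i < f y i}
    obtain ⟨x₀, ⟨hx₀K, hx₀⟩, hmax⟩ :=
      Set.Finite.exists_maximalFor' J (subK K f y) (Set.toFinite _) ⟨y, hyK, fun _ => le_rfl⟩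
    refine ⟨x₀, hx₀K, ?_, ⟨hx₀K, fun _ => le_rfl⟩, ?_⟩
    · obtain ⟨i, hi⟩ : ∃ i, ¬ f x₀ i < f y i := by
        by_contra! h
        exact hy ⟨x₀, hx₀K, h⟩
      refine ⟨i, fun x hx => (hx.2 i).antisymm ?_⟩
      have hJ : J x ⊆ J x₀ :=
        hmax ⟨hx.1, fun j => (hx.2 j).trans (hx₀ j)⟩ fun j hj => (hx.2 j).trans_lt hj
      exact (hx₀ i).trans (not_lt.mp fun h => hi (hJ h))
    · rintro ⟨x, hx, -, j, hj, hlt⟩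
      exact hlt.ne (hj x hx)
  · rintro ⟨x₀, hx₀K, ⟨i, hi⟩, -⟩
    refine ⟨x₀, hx₀K, ?_⟩
    rintro ⟨x, hxK, hx⟩
    exact (hx i).ne (hi x ⟨hxK, fun j => (hx j).le⟩)
end

section
/- Let K ⊆ ℝⁿ be a nonempty closed set, f : ℝⁿ → ℝˢ a continuous (in particular, locally Lipschitz) mapping, I ⊆ {1,…,s} a nonempty index set, and x₀ ∈ K. Assume that f is weakly section-bounded from below on K with respect to I and x₀, i.e., the set [f(K)]^I_{f(x₀)} is bounded. If f|_K is proper with respect to I at the sublevel f(x₀), then the set {x ∈ K : f_i(x) ≤ f_i(x₀) for all i = 1,…,s} is compact and the section [f(K)]_{f(x₀)} is compact. -/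
open Filter

theorem stmt_9 {n s : ℕ} (K : Set (Fin n → ℝ)) (hKne : K.Nonempty)
    (hKcl : IsClosed K) (f : (Fin n → ℝ) → Fin s → ℝ) (hf : Continuous f)
    (I : Finset (Fin s)) (hI : I.Nonempty) (x₀ : Fin n → ℝ) (hx₀ : x₀ ∈ K)
    -- f is weakly section-bounded from below on K w.r.t. I and x₀:
    -- the set [f(K)]^I_{f(x₀)} is bounded
    (hbdd : Bornology.IsBounded
      {y : I → ℝ | ∃ x ∈ K, (∀ i, f x i ≤ f x₀ i) ∧ y = fun i : I => f x i.1})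
    -- f|_K is proper with respect to I at the sublevel f(x₀)
    (hproper : ∀ u : ℕ → (Fin n → ℝ), (∀ k, u k ∈ K) →
      Tendsto (fun k => ‖u k‖) atTop atTop →
      (∀ k, ∀ i, f (u k) i ≤ f x₀ i) →
      Tendsto (fun k => ‖fun i : I => f (u k) i.1‖) atTop atTop) :
    IsCompact {x ∈ K | ∀ i, f x i ≤ f x₀ i} ∧
    IsCompact {y : Fin s → ℝ | ∃ x ∈ K, (∀ i, f x i ≤ f x₀ i) ∧ y = f x} := by
  have hcompact : IsCompact {x ∈ K | ∀ i, f x i ≤ f x₀ i} := by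
    refine Metric.isCompact_of_isClosed_isBounded ?_ ?_
    · exact hKcl.inter (isClosed_le hf continuous_const)
    · by_contra hunbdd
      rw [isBounded_iff_forall_norm_le] at hunbdd
      push Not at hunbdd
      choose u hu hlarge using fun k : ℕ => hunbdd k
      have hnorm : Tendsto (fun k => ‖u k‖) atTop atTop :=
        tendsto_atTop_mono (fun k => (hlarge k).le) tendsto_natCast_atTop_atTop
      have himage := hproper u (fun k => (hu k).1) hnorm fun k => (hu k).2
      obtain ⟨C, hC⟩ := isBounded_iff_forall_norm_le.mp hbdd
      obtain ⟨k, hk⟩ := (himage.eventually_gt_atTop C).exists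
      exact hk.not_ge (hC _ ⟨u k, (hu k).1, (hu k).2, rfl⟩)
  refine ⟨hcompact, ?_⟩
  convert hcompact.image hf using 1
  ext y
  simp only [Set.mem_ofPred_eq, Set.mem_image, and_assoc, eq_comm]
end

section
/- Let K be a nonempty subset of ℝⁿ and f : ℝⁿ → ℝˢ a mapping. If SOL^W(K, f) is nonempty, then there exist a nonempty index set I ⊆ {1,…,s} and a point x₀ ∈ K such that f is weakly section-bounded from below on K with respect to I and x₀; indeed one may choose x₀ ∈ SOL^W(K, f) and I so that the set [f(K)]^I_{f(x₀)} equals the singleton {f_I(x₀)}. -/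
/-- A point of `K` whose objective values do not exceed those of a weak Pareto efficient solution
is weak Pareto efficient itself. -/
theorem mem_SOLW_of_le {n s : ℕ} {K : Set (Fin n → ℝ)} {f : (Fin n → ℝ) → Fin s → ℝ}
    {x y : Fin n → ℝ} (hy : y ∈ SOLW K f) (hx : x ∈ K) (hxy : ∀ i, f x i ≤ f y i) :
    x ∈ SOLW K f :=
  ⟨hx, fun ⟨z, hz, hzx⟩ => hy.2 ⟨z, hz, fun i => (hzx i).trans_le (hxy i)⟩⟩

theorem stmt_10 {n s : ℕ} (K : Set (Fin n → ℝ)) (hK : K.Nonempty)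
    (f : (Fin n → ℝ) → Fin s → ℝ) (h : (SOLW K f).Nonempty) :
    ∃ (I : Finset (Fin s)) (x₀ : Fin n → ℝ), I.Nonempty ∧ x₀ ∈ SOLW K f ∧
      -- the set [f(K)]^I_{f(x₀)} equals the singleton {f_I(x₀)} …
      {y : I → ℝ | ∃ x ∈ K, (∀ i, f x i ≤ f x₀ i) ∧ y = fun i : I => f x i.1}
        = {fun i : I => f x₀ i.1} ∧
      -- … and in particular it is bounded, i.e. f is weakly section-bounded
      -- from below on K with respect to I and x₀
      Bornology.IsBounded
        {y : I → ℝ | ∃ x ∈ K, (∀ i, f x i ≤ f x₀ i) ∧ y = fun i : I => f x i.1} := by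
  classical
  obtain ⟨p, hp⟩ := h
  let D : (Fin n → ℝ) → Finset (Fin s) := fun x => Finset.univ.filter fun i => f x i < f p i
  -- the objectives strictly improved over `p`, taken at a point where this set is maximal
  obtain ⟨_, ⟨⟨x, hxK, hxp, rfl⟩, hmax⟩⟩ :=
    (Set.toFinite {d | ∃ x ∈ K, (∀ i, f x i ≤ f p i) ∧ D x = d}).exists_maximal
      ⟨D p, p, hp.1, fun _ => le_rfl, rfl⟩
  have hsingle : {y : ↥(D x)ᶜ → ℝ | ∃ z ∈ K, (∀ i, f z i ≤ f x i) ∧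
      y = fun i : ↥(D x)ᶜ => f z i.1} = {fun i : ↥(D x)ᶜ => f x i.1} := by
    ext y
    constructor
    · rintro ⟨z, hzK, hzx, rfl⟩
      have hsub : D z ⊆ D x :=
        hmax ⟨z, hzK, fun i => (hzx i).trans (hxp i), rfl⟩ fun i hi => by
          simp only [D, Finset.mem_filter_univ] at hi ⊢
          exact (hzx i).trans_lt hi
      funext ⟨i, hi⟩
      have hiz : i ∉ D z := fun h => Finset.mem_compl.mp hi (hsub h)
      simp only [D, Finset.mem_filter_univ, not_lt] at hiz
      exact le_antisymm (hzx i) ((hxp i).trans hiz)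
    · rintro rfl
      exact ⟨x, hxK, fun _ => le_rfl, rfl⟩
  refine ⟨(D x)ᶜ, x, ?_, mem_SOLW_of_le hp hxK hxp, hsingle, ?_⟩
  · by_contra hne
    rw [Finset.not_nonempty_iff_eq_empty, Finset.compl_eq_empty_iff] at hne
    exact hp.2 ⟨x, hxK, fun i => by simpa [D] using hne.ge (Finset.mem_univ i)⟩
  · rw [hsingle]
    exact Bornology.isBounded_singleton
end

section
/- Let K be a nonempty subset of ℝⁿ, f : ℝⁿ → ℝˢ a mapping, I = {s₁ < … < s_q} ⊆ {1,…,s} a nonempty index set, and x₀ ∈ K. Let Y := [f(K)]^I_{f(x₀)}, let α ∈ ℝ^q with α_i > 0 for all i, and let ȳ be a minimizer of y ↦ ⟨α, y⟩ over the closure of Y. Then every point x̄ ∈ K_{x₀} with f_I(x̄) = ȳ is a weak Pareto efficient solution of VOP(K, f). -/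
theorem stmt_13 {n s : ℕ} (K : Set (Fin n → ℝ)) (hK : K.Nonempty)
    (f : (Fin n → ℝ) → Fin s → ℝ) (I : Finset (Fin s)) (hI : I.Nonempty)
    (x₀ : Fin n → ℝ) (hx₀ : x₀ ∈ K)
    (α : I → ℝ) (hα : ∀ i, 0 < α i) (ybar : I → ℝ)
    -- ȳ is a minimizer of ⟨α, ·⟩ over the closure of Y = [f(K)]^I_{f(x₀)}
    (hmem : ybar ∈ closure
      {y : I → ℝ | ∃ x ∈ K, (∀ i, f x i ≤ f x₀ i) ∧ y = fun i : I => f x i.1})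
    (hmin : ∀ y ∈ closure
        {y : I → ℝ | ∃ x ∈ K, (∀ i, f x i ≤ f x₀ i) ∧ y = fun i : I => f x i.1},
      ∑ i, α i * ybar i ≤ ∑ i, α i * y i)
    (xbar : Fin n → ℝ) (hxbarK : xbar ∈ K) (hxbar : ∀ i, f xbar i ≤ f x₀ i)
    (hfx : (fun i : I => f xbar i.1) = ybar) :
    xbar ∈ SOLW K f := by
  refine ⟨hxbarK, fun ⟨x, hxK, hx⟩ => ?_⟩
  have hle := hmin (fun i : I => f x i.1)
    (subset_closure ⟨x, hxK, fun i => (hx i).le.trans (hxbar i), rfl⟩)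
  subst hfx
  have : Nonempty I := hI.to_subtype
  exact hle.not_gt (Finset.sum_lt_sum_of_nonempty Finset.univ_nonempty
    fun i _ => mul_lt_mul_of_pos_left (hx i.1) (hα i))
end

section
/- Let Ȳ ⊆ ℝ^q be a nonempty compact set and y⁰ ∈ ℝ^q be such that y_i ≤ y⁰_i for every y ∈ Ȳ and every i ∈ {1,…,q}. Let α ∈ ℝ^q with α_i > 0 for all i, and suppose ȳ is the unique minimizer of y ↦ ⟨α, y⟩ over Ȳ. Define J := {i ∈ {1,…,q} : ȳ_i < y⁰_i} and assume J is nonempty. Then the set of minimizers of y ↦ Σ_{i∈J} α_i y_i over Ȳ equals {ȳ}. -/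
theorem stmt_14 {q : ℕ} (Y : Set (Fin q → ℝ)) (hYne : Y.Nonempty)
    (hYc : IsCompact Y) (y0 : Fin q → ℝ) (hle : ∀ y ∈ Y, ∀ i, y i ≤ y0 i)
    (α : Fin q → ℝ) (hα : ∀ i, 0 < α i) (ybar : Fin q → ℝ)
    -- ȳ is the unique minimizer of ⟨α, ·⟩ over Y
    (hmem : ybar ∈ Y)
    (hmin : ∀ y ∈ Y, ∑ i, α i * ybar i ≤ ∑ i, α i * y i)
    (huniq : ∀ y ∈ Y, ∑ i, α i * y i = ∑ i, α i * ybar i → y = ybar)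
    -- J := {i : ȳᵢ < y⁰ᵢ} is nonempty
    (hJ : (Finset.univ.filter fun i => ybar i < y0 i).Nonempty) :
    -- the set of minimizers of y ↦ Σ_{i ∈ J} αᵢ yᵢ over Y equals {ȳ}
    {y ∈ Y | ∀ z ∈ Y,
        ∑ i ∈ Finset.univ.filter (fun i => ybar i < y0 i), α i * y i ≤
        ∑ i ∈ Finset.univ.filter (fun i => ybar i < y0 i), α i * z i}
      = {ybar} := by
  have hcompl : ∀ y ∈ Y, ∑ i ∈ Finset.univ.filter (fun i => ¬ ybar i < y0 i), α i * y i ≤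
      ∑ i ∈ Finset.univ.filter (fun i => ¬ ybar i < y0 i), α i * ybar i := by
    intro y hy
    refine Finset.sum_le_sum fun i hi => ?_
    have hi' : y0 i ≤ ybar i := not_lt.mp (Finset.mem_filter.mp hi).2
    exact mul_le_mul_of_nonneg_left ((hle y hy i).trans hi') (hα i).le
  have hsplit (y : Fin q → ℝ) :=
    Finset.sum_filter_add_sum_filter_not Finset.univ (fun i => ybar i < y0 i) fun i => α i * y i
  ext y
  simp only [Set.mem_ofPred_eq, Set.mem_singleton_iff]
  constructor
  · rintro ⟨hy, hymin⟩
    refine huniq y hy (le_antisymm ?_ (hmin y hy))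
    linarith [hymin ybar hmem, hcompl y hy, hsplit y, hsplit ybar]
  · rintro rfl
    refine ⟨hmem, fun z hz => ?_⟩
    linarith [hmin z hz, hcompl z hz, hsplit y, hsplit z]
end
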